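/- arXiv:2403.11917 — 2 statements merged into one kernel-verified Lean document; each statement's English description precedes it below -/
import Mathlib

section
/- Let α ∈ (0,1), L_α > 0, and let σ : ℝ → ℝ be α-Hölder continuous with constant L_α and satisfy the sublinear growth condition with constant C_σ > 0. For every real n with n ≥ 1 and n ≥ √C_σ, the inf-convolution σ_n satisfies, for all λ ∈ ℝ, 0 ≤ σ(λ) − σ_n(λ) ≤ (1−α) · L_α^{1/(1−α)} · (α/n)^{α/(1−α)} ≤ C_α, where C_α := (1−α) · L_α^{1/(1−α)} · α^{α/(1−α)}. -/
open Real

/-- Legendre transform bound for the power `r ^ α`, from the weighted AM-GM inequality. -/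
theorem mul_rpow_le_mul_add {α L n r : ℝ} (hα : 0 < α) (hα1 : α < 1) (hL : 0 ≤ L) (hn : 0 < n)
    (hr : 0 ≤ r) :
    L * r ^ α ≤ n * r + (1 - α) * L ^ (1 / (1 - α)) * (α / n) ^ (α / (1 - α)) := by
  have h1 : (0 : ℝ) < 1 - α := by linarith
  have hq : 0 ≤ α / n := by positivity
  have amgm := geom_mean_le_arith_mean2_weighted hα.le h1.le
    (show 0 ≤ r / (α / n) by positivity)
    (show 0 ≤ L ^ (1 / (1 - α)) * (α / n) ^ (α / (1 - α)) by positivity) (by ring)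
  rw [mul_rpow (by positivity) (by positivity), ← rpow_mul hL, ← rpow_mul hq,
    div_mul_cancel₀ _ h1.ne', div_mul_cancel₀ _ h1.ne', rpow_one, div_rpow hr hq] at amgm
  have hp : (α / n) ^ α ≠ 0 := by positivity
  calc L * r ^ α = r ^ α / (α / n) ^ α * (L * (α / n) ^ α) := by field_simp
    _ ≤ _ := amgm
    _ = _ := by
      field_simp

/-- For σ : ℝ → ℝ α-Hölder with constant L_α (α ∈ (0,1)) satisfying
the sublinear growth condition with constant C_σ > 0, and for every real n with
n ≥ 1 and n ≥ √C_σ, the inf-convolution σ_n(λ) = inf_μ (σ(μ) + n|λ−μ|) satisfies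
0 ≤ σ(λ) − σ_n(λ) ≤ (1−α)·L_α^{1/(1−α)}·(α/n)^{α/(1−α)} ≤ C_α for all λ, where
C_α = (1−α)·L_α^{1/(1−α)}·α^{α/(1−α)}. -/
theorem infConv_unif_bound (σ : ℝ → ℝ) (α Lα Cσ : ℝ)
    (hα : 0 < α) (hα1 : α < 1) (hL : 0 < Lα) (hCσ : 0 < Cσ)
    (hHolder : ∀ x y : ℝ, |σ x - σ y| ≤ Lα * |x - y| ^ α)
    (hgrowth : ∀ x : ℝ, |σ x| ^ 2 ≤ Cσ * (1 + |x| ^ 2))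
    (n : ℝ) (hn1 : 1 ≤ n) (hn : Real.sqrt Cσ ≤ n) (l : ℝ) :
    0 ≤ σ l - (⨅ μ : ℝ, σ μ + n * |l - μ|) ∧
    σ l - (⨅ μ : ℝ, σ μ + n * |l - μ|) ≤
      (1 - α) * Lα ^ (1 / (1 - α)) * (α / n) ^ (α / (1 - α)) ∧
    (1 - α) * Lα ^ (1 / (1 - α)) * (α / n) ^ (α / (1 - α)) ≤
      (1 - α) * Lα ^ (1 / (1 - α)) * α ^ (α / (1 - α)) := by
  have h1 : (0 : ℝ) < 1 - α := by linarith
  have hn0 : 0 < n := by linarith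
  have lower : ∀ μ : ℝ,
      σ l - (1 - α) * Lα ^ (1 / (1 - α)) * (α / n) ^ (α / (1 - α)) ≤ σ μ + n * |l - μ| := by
    intro μ
    have hσ := (le_abs_self _).trans (hHolder l μ)
    have hpow := mul_rpow_le_mul_add hα hα1 hL.le hn0 (abs_nonneg (l - μ))
    linarith
  refine ⟨?_, ?_, ?_⟩
  · have h := ciInf_le ⟨_, Set.forall_mem_range.2 lower⟩ l
    simp only [sub_self, abs_zero, mul_zero, add_zero] at h
    linarith
  · have h := le_ciInf lower
    linarith
  · gcongr
    exact div_le_self hα.le hn1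
end

section
/- Let α ∈ (0,1), L_α > 0, and let σ : ℝ → ℝ be α-Hölder continuous with constant L_α and satisfy the sublinear growth condition with constant C_σ > 0. For every real n with n ≥ 1 and n ≥ √C_σ, the inf-convolution σ_n satisfies the uniform quadratic growth bound |σ_n(λ)|² ≤ 2·(C_α² + C_σ·(1+|λ|²)) for all λ ∈ ℝ, where C_α := (1−α) · L_α^{1/(1−α)} · α^{α/(1−α)}. -/
open Real

/-- The function `t ↦ L * t ^ α - t` on `[0, ∞)` is bounded by its maximum
`(1 - α) * L ^ (1 / (1 - α)) * α ^ (α / (1 - α))`. -/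
theorem mul_rpow_le_add_const {α L t : ℝ} (hα : 0 < α) (hα1 : α < 1) (hL : 0 < L) (ht : 0 ≤ t) :
    L * t ^ α ≤ t + (1 - α) * L ^ (1 / (1 - α)) * α ^ (α / (1 - α)) := by
  have h1 : 0 < 1 - α := sub_pos.2 hα1
  have h := Real.geom_mean_le_arith_mean2_weighted hα.le h1.le (div_nonneg ht hα.le)
    (by positivity : 0 ≤ L ^ (1 / (1 - α)) * α ^ (α / (1 - α))) (by ring)
  rw [Real.mul_rpow (by positivity) (by positivity), ← Real.rpow_mul hL.le,
    ← Real.rpow_mul hα.le, div_mul_cancel₀ _ h1.ne', div_mul_cancel₀ _ h1.ne', Real.rpow_one,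
    Real.div_rpow ht hα.le, mul_div_cancel₀ _ hα.ne'] at h
  have hαα : α ^ α ≠ 0 := (Real.rpow_pos_of_pos hα α).ne'
  calc L * t ^ α = t ^ α / α ^ α * (L * α ^ α) := by field_simp
    _ ≤ _ := h
    _ = _ := by ring

/-- The inf-convolution of a Hölder function with parameter `n ≥ 1` is uniformly close to it. -/
theorem abs_infConv_sub_le {σ : ℝ → ℝ} {α L n : ℝ} (hα : 0 < α) (hα1 : α < 1) (hL : 0 < L)
    (hσ : ∀ x y : ℝ, |σ x - σ y| ≤ L * |x - y| ^ α) (hn : 1 ≤ n) (l : ℝ) :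
    |(⨅ μ : ℝ, σ μ + n * |l - μ|) - σ l| ≤
      (1 - α) * L ^ (1 / (1 - α)) * α ^ (α / (1 - α)) := by
  set C := (1 - α) * L ^ (1 / (1 - α)) * α ^ (α / (1 - α))
  have hlow (μ : ℝ) : σ l - C ≤ σ μ + n * |l - μ| := by
    have h1 := (le_abs_self _).trans (hσ l μ)
    have h2 := mul_rpow_le_add_const hα hα1 hL (abs_nonneg (l - μ))
    have h3 := le_mul_of_one_le_left (abs_nonneg (l - μ)) hn
    linarith
  have hle : (⨅ μ : ℝ, σ μ + n * |l - μ|) ≤ σ l := by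
    refine (ciInf_le ⟨σ l - C, Set.forall_mem_range.2 hlow⟩ l).trans_eq ?_
    simp
  have hge := le_ciInf hlow
  rw [abs_le]
  constructor <;> linarith

/-- For σ : ℝ → ℝ α-Hölder with constant L_α (α ∈ (0,1)) satisfying
the sublinear growth condition with constant C_σ > 0, and for every real n with
n ≥ 1 and n ≥ √C_σ, the inf-convolution σ_n(λ) = inf_μ (σ(μ) + n|λ−μ|) satisfies
|σ_n(λ)|² ≤ 2·(C_α² + C_σ·(1+|λ|²)) for all λ ∈ ℝ, where
C_α = (1−α)·L_α^{1/(1−α)}·α^{α/(1−α)}. -/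
theorem infConv_quadratic_growth (σ : ℝ → ℝ) (α Lα Cσ : ℝ)
    (hα : 0 < α) (hα1 : α < 1) (hL : 0 < Lα) (hCσ : 0 < Cσ)
    (hHolder : ∀ x y : ℝ, |σ x - σ y| ≤ Lα * |x - y| ^ α)
    (hgrowth : ∀ x : ℝ, |σ x| ^ 2 ≤ Cσ * (1 + |x| ^ 2))
    (n : ℝ) (hn1 : 1 ≤ n) (hn : Real.sqrt Cσ ≤ n) (l : ℝ) :
    |(⨅ μ : ℝ, σ μ + n * |l - μ|)| ^ 2 ≤
      2 * (((1 - α) * Lα ^ (1 / (1 - α)) * α ^ (α / (1 - α))) ^ 2 + Cσ * (1 + |l| ^ 2)) := by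
  have hC := abs_infConv_sub_le hα hα1 hL hHolder hn1 l
  have hσ := hgrowth l
  set s := ⨅ μ : ℝ, σ μ + n * |l - μ|
  have hsq := pow_le_pow_left₀ (abs_nonneg _) hC 2
  rw [sq_abs] at hsq hσ ⊢
  nlinarith [add_sq_le (a := s - σ l) (b := σ l)]
end
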